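/- arXiv:1901.06413 — 3 statements merged into one kernel-verified Lean document; each statement's English description precedes it below -/
import Mathlib

section
/- There exist constants C₁ > 0, γ > 0 and δ₀ > 0, depending only on σ², with the following property. Let x₁, …, xₙ be i.i.d. samples in ℝᵖ from a distribution with mean zero and sub-Gaussian marginals with parameter σ², let Σ = (σ_{ij}) be its covariance matrix and Σ* = (σ*_{ij}) = (1/n)·Σ_{k=1}^n xₖxₖᵀ the empirical covariance matrix. Then for all indices 1 ≤ i, j ≤ p and all t with 0 < t ≤ δ₀, P(|σ*_{ij} − σ_{ij}| > t) ≤ C₁·exp(−8·n·t²/γ²). -/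
open MeasureTheory ProbabilityTheory Real

/-- A distribution `ν` on `ℝᵖ` has sub-Gaussian marginals with parameter `σ2`:
for every unit vector `v` and every `t > 0`, `ν {x | |⟨v,x⟩| > t} ≤ exp(−t²/(2σ2))`. -/
def SubGaussianMarginals (p : ℕ) (σ2 : ℝ) (ν : Measure (Fin p → ℝ)) : Prop :=
  ∀ v : Fin p → ℝ, (∑ i, v i ^ 2) = 1 → ∀ t : ℝ, 0 < t →
    ν {x | t < |∑ i, v i * x i|} ≤ ENNReal.ofReal (Real.exp (-(t ^ 2) / (2 * σ2)))

/-- A distribution `ν` on `ℝᵖ` has mean zero. -/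
def MeanZero (p : ℕ) (ν : Measure (Fin p → ℝ)) : Prop :=
  ∀ i : Fin p, ∫ x, x i ∂ν = 0

/-- The population covariance matrix `Σ = E[x xᵀ]` of a mean-zero distribution `ν`. -/
noncomputable def popCov (p : ℕ) (ν : Measure (Fin p → ℝ)) :
    Matrix (Fin p) (Fin p) ℝ :=
  Matrix.of fun i j => ∫ x, x i * x j ∂ν

/-- The empirical covariance matrix `Σ* = (1/n)·∑ₖ xₖ xₖᵀ` of `n` samples. -/
noncomputable def empCov (p n : ℕ) (x : Fin n → Fin p → ℝ) :
    Matrix (Fin p) (Fin p) ℝ :=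
  Matrix.of fun i j => (1 / n : ℝ) * ∑ k, x k i * x k j

lemma lint_exp_sq {Ω : Type*} [MeasurableSpace Ω] (ν : Measure Ω) [IsProbabilityMeasure ν]
    (X : Ω → ℝ) (hX : Measurable X) (σ2 : ℝ) (hσ : 0 < σ2)
    (h : ∀ t : ℝ, 0 < t → ν {x | t < |X x|} ≤ ENNReal.ofReal (Real.exp (-(t ^ 2) / (2 * σ2)))) :
    ∫⁻ x, ENNReal.ofReal (exp (1 / (4 * σ2) * X x ^ 2)) ∂ν ≤ 2 := by
  rw [lintegral_eq_lintegral_meas_lt ν (Filter.Eventually.of_forall fun x => (exp_pos _).le)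
    (by fun_prop)]
  rw [← Set.Ioc_union_Ioi_eq_Ioi (zero_le_one' ℝ),
    lintegral_union measurableSet_Ioi (Set.Ioc_disjoint_Ioi le_rfl)]
  have h1 : ∫⁻ t in Set.Ioc (0:ℝ) 1, ν {a | t < exp (1 / (4 * σ2) * X a ^ 2)} ≤ 1 := by
    calc _ ≤ ∫⁻ t in Set.Ioc (0:ℝ) 1, 1 := lintegral_mono fun t => prob_le_one
      _ = 1 := by simp
  have h2 : ∫⁻ t in Set.Ioi (1:ℝ), ν {a | t < exp (1 / (4 * σ2) * X a ^ 2)} ≤ 1 := by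
    calc _ ≤ ∫⁻ t in Set.Ioi (1:ℝ), ENNReal.ofReal (t ^ (-2 : ℝ)) := by
          refine setLIntegral_mono' measurableSet_Ioi fun t ht => ?_
          have ht : 1 < t := ht
          have hl : 0 < log t := log_pos ht
          have hs : 0 < 4 * σ2 * log t := by positivity
          refine le_trans (measure_mono ?_) ((h (√(4 * σ2 * log t)) (sqrt_pos.2 hs)).trans ?_)
          · intro a ha
            have ha : t < exp (1 / (4 * σ2) * X a ^ 2) := ha
            rw [← log_lt_iff_lt_exp (by linarith)] at ha
            show √(4 * σ2 * log t) < |X a|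
            rw [← sqrt_sq_eq_abs]
            apply sqrt_lt_sqrt hs.le
            rw [one_div, inv_mul_eq_div, lt_div_iff₀ (by positivity)] at ha
            linarith
          · apply ENNReal.ofReal_le_ofReal
            rw [sq_sqrt hs.le, rpow_def_of_pos (by linarith)]
            apply le_of_eq
            congr 1
            field_simp
            ring
      _ = 1 := by
          rw [← ofReal_integral_eq_lintegral_ofReal
            (integrableOn_Ioi_rpow_of_lt (by norm_num) one_pos), integral_Ioi_rpow_of_lt (by norm_num) one_pos]
          · norm_num
          · refine (ae_restrict_mem measurableSet_Ioi).mono fun t ht => ?_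
            have ht : 1 < t := ht
            show 0 ≤ t ^ (-2:ℝ)
            positivity
  calc _ ≤ (1:ENNReal) + 1 := add_le_add h1 h2
    _ = 2 := by norm_num

lemma exp_quad (y : ℝ) : exp y ≤ 1 + y + y ^ 2 * exp |y| := by
  have := Complex.norm_exp_sub_sum_le_norm_mul_exp (y : ℂ) 2
  simp only [Finset.sum_range_succ, Finset.sum_range_zero] at this
  have h2 : ‖((exp y - (1 + y) : ℝ) : ℂ)‖ ≤ |y| ^ 2 * exp |y| := by
    simpa using this
  rw [Complex.norm_real, norm_eq_abs, sq_abs] at h2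
  linarith [le_abs_self (exp y - (1 + y))]

lemma mgf_bound {Ω : Type*} [MeasurableSpace Ω] (ν : Measure Ω) [IsProbabilityMeasure ν]
    (Y : Ω → ℝ) (hY : Measurable Y) (s : ℝ) (hs : 0 < s)
    (hi : Integrable (fun x => exp (s * |Y x|)) ν) (hE : ∫ x, exp (s * |Y x|) ∂ν ≤ 2)
    (l : ℝ) (hl : |l| ≤ s / 2) :
    Integrable (fun x => exp (l * (Y x - ∫ y, Y y ∂ν))) ν ∧
    mgf (fun x => Y x - ∫ y, Y y ∂ν) ν l ≤ exp (16 * l ^ 2 / s ^ 2) := by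
  have hYi : Integrable Y ν := by
    refine (hi.const_mul (1 / s)).mono' hY.aestronglyMeasurable (.of_forall fun x => ?_)
    rw [norm_eq_abs, one_div, inv_mul_eq_div, le_div_iff₀ hs]
    linarith [add_one_le_exp (s * |Y x|)]
  have hle : Integrable (fun x => exp (l * Y x)) ν := by
    refine hi.mono' (by fun_prop) (.of_forall fun x => ?_)
    rw [norm_eq_abs, abs_exp]
    apply exp_le_exp.2
    calc l * Y x ≤ |l * Y x| := le_abs_self _
      _ = |l| * |Y x| := abs_mul _ _
      _ ≤ s * |Y x| := by gcongr; linarith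
  have hpt : ∀ x, exp (l * Y x) ≤ 1 + l * Y x + 8 * l ^ 2 / s ^ 2 * exp (s * |Y x|) := by
    intro x
    refine (exp_quad _).trans ?_
    suffices hsuf : (l * Y x) ^ 2 * exp |l * Y x| ≤ 8 * l ^ 2 / s ^ 2 * exp (s * |Y x|) by linarith
    have h1 : exp |l * Y x| ≤ exp (s / 2 * |Y x|) := by
      rw [abs_mul]; gcongr
    have h2 := quadratic_le_exp_of_nonneg (x := s / 2 * |Y x|) (by positivity)
    have h3 : Y x ^ 2 ≤ 8 / s ^ 2 * exp (s / 2 * |Y x|) := by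
      rw [div_mul_eq_mul_div, le_div_iff₀ (by positivity)]
      have : 0 ≤ s / 2 * |Y x| := by positivity
      have h4 : (s / 2 * |Y x|) ^ 2 = s ^ 2 / 4 * Y x ^ 2 := by
        rw [mul_pow, sq_abs]; ring
      rw [h4] at h2
      linarith
    calc (l * Y x) ^ 2 * exp |l * Y x| = l ^ 2 * (Y x ^ 2 * exp |l * Y x|) := by ring
      _ ≤ l ^ 2 * ((8 / s ^ 2 * exp (s / 2 * |Y x|)) * exp (s / 2 * |Y x|)) := by gcongr
      _ = 8 * l ^ 2 / s ^ 2 * (exp (s / 2 * |Y x|) * exp (s / 2 * |Y x|)) := by ring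
      _ = _ := by rw [← exp_add]; ring_nf
  set m := ∫ y, Y y ∂ν with hm
  have hfun : ∀ x, exp (l * (Y x - m)) = exp (-(l * m)) * exp (l * Y x) := by
    intro x; rw [← exp_add]; ring_nf
  refine ⟨by simp_rw [hfun]; exact hle.const_mul _, ?_⟩
  have hI : ∫ x, exp (l * Y x) ∂ν ≤ 1 + l * m + 16 * l ^ 2 / s ^ 2 := by
    have hi1 : Integrable (fun x => 1 + l * Y x) ν := (integrable_const _).add (hYi.const_mul l)
    have hi2 : Integrable (fun x => 8 * l ^ 2 / s ^ 2 * exp (s * |Y x|)) ν := hi.const_mul _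
    calc _ ≤ ∫ x, (1 + l * Y x + 8 * l ^ 2 / s ^ 2 * exp (s * |Y x|)) ∂ν :=
          integral_mono hle (hi1.add hi2) hpt
      _ = 1 + l * m + 8 * l ^ 2 / s ^ 2 * ∫ x, exp (s * |Y x|) ∂ν := by
          rw [integral_add hi1 hi2, integral_add (integrable_const _) (hYi.const_mul l),
            integral_const_mul, integral_const_mul]
          simp [hm]
      _ ≤ 1 + l * m + 8 * l ^ 2 / s ^ 2 * 2 := by gcongr
      _ = _ := by ring
  unfold mgf
  simp_rw [hfun]
  rw [integral_const_mul]
  calc _ ≤ exp (-(l * m)) * exp (l * m + 16 * l ^ 2 / s ^ 2) := by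
        gcongr
        refine hI.trans ?_
        linarith [add_one_le_exp (l * m + 16 * l ^ 2 / s ^ 2)]
    _ = _ := by rw [← exp_add]; ring_nf

lemma chernoff {Ω : Type*} [MeasurableSpace Ω] (ν : Measure Ω) [IsProbabilityMeasure ν]
    (f : Ω → ℝ) (hf : Measurable f) (n : ℕ) (l B t : ℝ) (hl : 0 ≤ l)
    (hi : Integrable (fun x => exp (l * f x)) ν) (hB : mgf f ν l ≤ exp B) :
    (Measure.pi fun _ : Fin n => ν).real {x | n * t ≤ ∑ k, f (x k)}
      ≤ exp (n * (B - l * t)) := by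
  set P := (Measure.pi fun _ : Fin n => ν)
  have hpres : ∀ k : Fin n, MeasurePreserving (fun x : Fin n → Ω => x k) P ν :=
    fun k => measurePreserving_eval _ k
  have hind : iIndepFun (fun (k : Fin n) (x : Fin n → Ω) => f (x k)) P :=
    iIndepFun_pi (X := fun _ => f) (fun _ => hf.aemeasurable)
  have hm : ∀ k : Fin n, Measurable (fun x : Fin n → Ω => f (x k)) :=
    fun k => hf.comp (measurable_pi_apply k)
  have hint : ∀ k : Fin n, Integrable (fun x : Fin n → Ω => exp (l * f (x k))) P :=
    fun k => (hpres k).integrable_comp_of_integrable hi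
  have hS := hind.integrable_exp_mul_sum (t := l) hm (s := Finset.univ) (fun k _ => hint k)
  have h := measure_ge_le_exp_mul_mgf (μ := P) (n * t) hl hS
  rw [hind.mgf_sum hm] at h
  simp only [Finset.sum_apply] at h
  refine h.trans ?_
  have he : ∀ k : Fin n, mgf (fun x : Fin n → Ω => f (x k)) P l = mgf f ν l := by
    intro k
    have := mgf_map (μ := P) (Y := fun x : Fin n → Ω => x k) (X := f) (t := l) (hpres k).aemeasurable
      (by fun_prop)
    rw [(hpres k).map_eq] at this
    rw [this]; rfl
  simp_rw [he]
  rw [Finset.prod_const, Finset.card_univ, Fintype.card_fin]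
  calc _ ≤ exp (-l * (n * t)) * exp B ^ n := by
        gcongr; exact mgf_nonneg
    _ = _ := by rw [← exp_nat_mul, ← exp_add]; ring_nf

/-- there exist constants `C₁, γ, δ₀ > 0` depending only on `σ2` such that for
i.i.d. mean-zero sub-Gaussian samples (modeled by the product measure `ν^n`), every entry of
the empirical covariance matrix concentrates around the corresponding entry of the population
covariance matrix: `P(|σ*_{ij} − σ_{ij}| > t) ≤ C₁·exp(−8·n·t²/γ²)` for all `0 < t ≤ δ₀`. -/
theorem empCov_entrywise_concentration (σ2 : ℝ) (hσ2 : 0 < σ2) :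
    ∃ C₁ γ δ₀ : ℝ, 0 < C₁ ∧ 0 < γ ∧ 0 < δ₀ ∧
      ∀ (p n : ℕ), 1 ≤ n →
      ∀ (ν : Measure (Fin p → ℝ)) [IsProbabilityMeasure ν],
        SubGaussianMarginals p σ2 ν → MeanZero p ν →
        ∀ i j : Fin p, ∀ t : ℝ, 0 < t → t ≤ δ₀ →
          (Measure.pi fun _ : Fin n => ν)
              {x | t < |empCov p n x i j - popCov p ν i j|}
            ≤ ENNReal.ofReal (C₁ * Real.exp (-8 * n * t ^ 2 / γ ^ 2)) := by
  refine ⟨2, 128 * σ2, 64 * σ2, by norm_num, by positivity, by positivity, ?_⟩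
  intro p n hn ν _ hsub _ i j t ht htd
  set s : ℝ := 1 / (4 * σ2) with hs_def
  have hs : 0 < s := by positivity
  have hlin : ∀ i : Fin p, ∫⁻ x, ENNReal.ofReal (exp (s * x i ^ 2)) ∂ν ≤ 2 := by
    intro i
    refine lint_exp_sq ν (fun x => x i) (measurable_pi_apply i) σ2 hσ2 fun t ht => ?_
    simpa [Pi.single_apply] using hsub (Pi.single i 1) (by simp [Pi.single_apply]) t ht
  have hInt : ∀ i : Fin p, Integrable (fun x : Fin p → ℝ => exp (s * x i ^ 2)) ν := by
    intro i
    refine ⟨Measurable.aestronglyMeasurable (by fun_prop), ?_⟩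
    rw [hasFiniteIntegral_iff_ofReal (.of_forall fun x => (exp_pos _).le)]
    exact (hlin i).trans_lt (by norm_num)
  have hE : ∀ i : Fin p, ∫ x, exp (s * x i ^ 2) ∂ν ≤ 2 := by
    intro i
    rw [integral_eq_lintegral_of_nonneg_ae (.of_forall fun x => (exp_pos _).le) (Measurable.aestronglyMeasurable (by fun_prop))]
    exact ENNReal.toReal_le_of_le_ofReal (by norm_num) (by simpa using hlin i)
  have hYm : Measurable (fun x : Fin p → ℝ => x i * x j) := by fun_prop
  have hpt : ∀ x : Fin p → ℝ,
      exp (s * |x i * x j|) ≤ (exp (s * x i ^ 2) + exp (s * x j ^ 2)) / 2 := by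
    intro x
    have h1 : exp (s * |x i * x j|) ≤ exp (s * x i ^ 2 / 2) * exp (s * x j ^ 2 / 2) := by
      rw [← exp_add]
      apply exp_le_exp.2
      have : |x i * x j| ≤ (x i ^ 2 + x j ^ 2) / 2 := by
        rw [abs_le]
        constructor <;> nlinarith [sq_nonneg (x i + x j), sq_nonneg (x i - x j)]
      calc _ ≤ s * ((x i ^ 2 + x j ^ 2) / 2) := by gcongr
        _ = _ := by ring
    have h2 : ∀ a : ℝ, exp a = exp (a / 2) ^ 2 := by
      intro a; rw [← exp_nat_mul]; congr 1; push_cast; ring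
    rw [h2 (s * x i ^ 2), h2 (s * x j ^ 2)]
    nlinarith [sq_nonneg (exp (s * x i ^ 2 / 2) - exp (s * x j ^ 2 / 2))]
  have hi2 : Integrable (fun x : Fin p → ℝ => (exp (s * x i ^ 2) + exp (s * x j ^ 2)) / 2) ν :=
    ((hInt i).add (hInt j)).div_const 2
  have hYi : Integrable (fun x : Fin p → ℝ => exp (s * |x i * x j|)) ν := by
    refine hi2.mono' (by fun_prop) (.of_forall fun x => ?_)
    rw [norm_eq_abs, abs_exp]
    exact hpt x
  have hYE : ∫ x, exp (s * |x i * x j|) ∂ν ≤ 2 := by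
    refine (integral_mono hYi hi2 hpt).trans ?_
    rw [integral_div, integral_add (hInt i) (hInt j)]
    linarith [hE i, hE j]
  set m : ℝ := ∫ x, x i * x j ∂ν with hm
  set l : ℝ := s ^ 2 * t / 32 with hl_def
  have hl0 : 0 ≤ l := by positivity
  have hst : s * t ≤ 16 := by
    rw [hs_def, one_div, inv_mul_eq_div, div_le_iff₀ (by positivity)]; linarith
  have hl : l ≤ s / 2 := by
    rw [hl_def]; nlinarith
  obtain ⟨a1, a2⟩ := mgf_bound ν _ hYm s hs hYi hYE l (by rwa [abs_of_nonneg hl0])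
  obtain ⟨b1, b2⟩ := mgf_bound ν _ hYm s hs hYi hYE (-l) (by rwa [abs_neg, abs_of_nonneg hl0])
  rw [← hm] at a1 a2 b1 b2
  have c1 := chernoff ν (fun x => x i * x j - m) (by fun_prop) n l _ t hl0 a1 a2
  have c2 := chernoff ν (fun x => -(x i * x j - m)) (by fun_prop) n l _ t hl0
    (by simpa only [neg_mul, mul_neg] using b1)
    (by
      have := mgf_neg (X := fun x : Fin p → ℝ => x i * x j - m) (μ := ν) (t := l)
      rw [← this] at b2
      exact b2)
  have hn0 : (0 : ℝ) < n := by exact_mod_cast hn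
  have hexp : exp (n * (16 * l ^ 2 / s ^ 2 - l * t)) ≤ exp (-8 * n * t ^ 2 / (128 * σ2) ^ 2) := by
    apply exp_le_exp.2
    have e1 : n * (16 * l ^ 2 / s ^ 2 - l * t) = -(n * t ^ 2 / (1024 * σ2 ^ 2)) := by
      rw [hl_def, hs_def]; field_simp; ring
    have e2 : -8 * n * t ^ 2 / (128 * σ2) ^ 2 = -(n * t ^ 2 / (1024 * σ2 ^ 2)) / 2 := by
      field_simp; ring
    rw [e1, e2]
    have : 0 ≤ n * t ^ 2 / (1024 * σ2 ^ 2) := by positivity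
    linarith
  rw [neg_sq] at c2
  refine (measure_mono (t := {x | n * t ≤ ∑ k, (x k i * x k j - m)} ∪
    {x | n * t ≤ ∑ k, -(x k i * x k j - m)}) ?_).trans ?_
  · intro x hx
    have hx : t < |empCov p n x i j - popCov p ν i j| := hx
    have hx2 : empCov p n x i j - popCov p ν i j = (∑ k, (x k i * x k j - m)) / n := by
      simp only [empCov, popCov, Matrix.of_apply, ← hm, Finset.sum_sub_distrib, Finset.sum_const,
        Finset.card_univ, Fintype.card_fin, nsmul_eq_mul]
      field_simp
    rw [hx2, lt_abs, ← neg_div, lt_div_iff₀ hn0, lt_div_iff₀ hn0] at hx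
    rcases hx with hx | hx
    · left
      show n * t ≤ _
      linarith
    · right
      show n * t ≤ _
      rw [Finset.sum_neg_distrib]
      linarith
  · refine (measure_union_le _ _).trans ?_
    rw [← ofReal_measureReal, ← ofReal_measureReal, ← ENNReal.ofReal_add (by positivity) (by positivity)]
    apply ENNReal.ofReal_le_ofReal
    linarith
end

section
/- (Gaussian mechanism.) Let 0 < ε ≤ 1 and 0 < δ ≤ 1, let q, q' ∈ ℝᵖ with ‖q − q'‖₂ ≤ Δ for some Δ > 0, and let σ ≥ √(2·ln(1.25/δ))·Δ/ε. Let μ and μ' be the laws of q + Y and q' + Y respectively, where Y ∈ ℝᵖ has i.i.d. N(0, σ²) coordinates. Then for every measurable set S ⊆ ℝᵖ, μ(S) ≤ e^ε · μ'(S) + δ. -/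
open MeasureTheory ProbabilityTheory Real

lemma gm_real_density (a b : ℝ) {v : NNReal} (hv : v ≠ 0) :
    gaussianReal a v = (gaussianReal b v).withDensity
      (fun x => ENNReal.ofReal (Real.exp (((x - b) ^ 2 - (x - a) ^ 2) / (2 * v)))) := by
  rw [gaussianReal_of_var_ne_zero _ hv, gaussianReal_of_var_ne_zero _ hv,
    ← withDensity_mul _ (measurable_gaussianPDF b v) (by fun_prop)]
  congr 1
  ext x
  simp only [Pi.mul_apply, gaussianPDF]
  rw [← ENNReal.ofReal_mul (gaussianPDFReal_nonneg _ _ _)]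
  congr 1
  simp only [gaussianPDFReal]
  rw [mul_assoc _ (Real.exp _), ← Real.exp_add]
  congr 2
  ring

lemma gm_pi_density {p : ℕ} (μ : Fin p → Measure ℝ) [∀ i, IsProbabilityMeasure (μ i)]
    (f : Fin p → ℝ → ENNReal) (hf : ∀ i, Measurable (f i))
    [∀ i, IsProbabilityMeasure ((μ i).withDensity (f i))] :
    Measure.pi (fun i => (μ i).withDensity (f i))
      = (Measure.pi μ).withDensity (fun x => ∏ i, f i (x i)) := by
  refine Measure.pi_eq fun s hs => ?_
  rw [withDensity_apply _ (MeasurableSet.univ_pi hs),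
    ← lintegral_indicator (MeasurableSet.univ_pi hs)]
  have h1 : (Set.univ.pi s).indicator (fun x : Fin p → ℝ => ∏ i, f i (x i))
      = fun x => ∏ i, ((s i).indicator (f i)) (x i) := by
    ext x
    by_cases hx : x ∈ Set.univ.pi s
    · rw [Set.indicator_of_mem hx]
      refine Finset.prod_congr rfl fun i _ => ?_
      rw [Set.indicator_of_mem (hx i (Set.mem_univ i))]
    · rw [Set.indicator_of_notMem hx]
      simp only [Set.mem_pi, Set.mem_univ, true_imp_iff, not_forall] at hx
      obtain ⟨i, hi⟩ := hx
      exact (Finset.prod_eq_zero (Finset.mem_univ i) (Set.indicator_of_notMem hi _)).symm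
  have hm : ∀ i, Measurable ((s i).indicator (f i)) := fun i => (hf i).indicator (hs i)
  rw [h1, lintegral_prod_eq_prod_lintegral_of_indepFun Finset.univ
    (fun i (x : Fin p → ℝ) => ((s i).indicator (f i)) (x i))
    (iIndepFun_pi (fun i => (hm i).aemeasurable))
    (fun i => (hm i).comp (measurable_pi_apply i))]
  refine Finset.prod_congr rfl fun i _ => ?_
  rw [withDensity_apply _ (hs i), ← lintegral_indicator (hs i),
    ← (measurePreserving_eval μ i).map_eq, lintegral_map (hm i) (measurable_pi_apply i)]

lemma gm_half : gaussianReal 0 1 (Set.Ioi 0) ≤ ENNReal.ofReal (1 / 2) := by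
  have h : gaussianReal 0 1 (Set.Iio 0) = gaussianReal 0 1 (Set.Ioi 0) := by
    have h2 := gaussianReal_map_neg (μ := 0) (v := 1)
    rw [neg_zero] at h2
    conv_lhs => rw [← h2]
    rw [Measure.map_apply (by fun_prop) measurableSet_Iio]
    congr 1
    ext x
    simp
  have h3 : gaussianReal 0 1 (Set.Iio 0 ∪ Set.Ioi 0) ≤ 1 := prob_le_one
  rw [measure_union (by
    rw [Set.disjoint_left]; intro x hx hx'; exact lt_asymm (Set.mem_Iio.1 hx) (Set.mem_Ioi.1 hx')) measurableSet_Ioi, h] at h3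
  rw [← ENNReal.ofReal_toReal (measure_ne_top (gaussianReal 0 1) (Set.Ioi 0))] at h3 ⊢
  rw [← ENNReal.ofReal_add (by positivity) (by positivity), ENNReal.ofReal_le_one] at h3
  exact ENNReal.ofReal_le_ofReal (by linarith)

lemma gm_tail_pos {t : ℝ} (ht : 0 ≤ t) :
    gaussianReal 0 1 (Set.Ioi t) ≤ ENNReal.ofReal (Real.exp (-t ^ 2 / 2) * (1 / 2)) := by
  rw [gm_real_density 0 t (one_ne_zero), withDensity_apply _ measurableSet_Ioi]
  calc _ ≤ ∫⁻ x in Set.Ioi t, ENNReal.ofReal (Real.exp (-t ^ 2 / 2)) ∂(gaussianReal t 1) := by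
        refine setLIntegral_mono measurable_const fun x hx => ?_
        have hx : t < x := hx
        refine ENNReal.ofReal_le_ofReal (Real.exp_le_exp.2 ?_)
        simp only [NNReal.coe_one]
        nlinarith
    _ = ENNReal.ofReal (Real.exp (-t ^ 2 / 2)) * gaussianReal t 1 (Set.Ioi t) := by
        simp
    _ ≤ _ := by
        rw [ENNReal.ofReal_mul (Real.exp_pos _).le]
        gcongr
        refine le_trans (le_of_eq ?_) gm_half
        have h2 := gaussianReal_map_const_add (μ := 0) (v := 1) t
        rw [zero_add] at h2
        rw [← h2, Measure.map_apply (by fun_prop) measurableSet_Ioi]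
        congr 1
        ext x
        simp

lemma gm_tail_neg {t : ℝ} (ht : t ≤ 0) :
    gaussianReal 0 1 (Set.Ioi t) ≤ ENNReal.ofReal (-t + 1 / 2) := by
  rw [← Set.Ioc_union_Ioi_eq_Ioi ht, ENNReal.ofReal_add (by linarith) (by norm_num)]
  refine (measure_union_le _ _).trans (add_le_add ?_ gm_half)
  rw [gaussianReal_apply _ one_ne_zero]
  calc _ ≤ ∫⁻ x in Set.Ioc t 0, 1 := by
        refine setLIntegral_mono measurable_const fun x _ => ?_
        rw [gaussianPDF, ENNReal.ofReal_le_one]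
        simp only [gaussianPDFReal]
        refine mul_le_one₀ ?_ (Real.exp_pos _).le ?_
        · refine inv_le_one_of_one_le₀ ?_
          rw [Real.one_le_sqrt]
          simp only [NNReal.coe_one]
          linarith [Real.pi_gt_three]
        · rw [Real.exp_le_one_iff]
          simp only [NNReal.coe_one]
          nlinarith [sq_nonneg (x - 0)]
    _ = _ := by simp

/-- Tail estimate with the constant 1.25. -/
lemma gm_tail {ε δ c : ℝ} (hε : 0 < ε) (hε1 : ε ≤ 1) (hδ : 0 < δ) (hδ1 : δ ≤ 1)
    (hc : Real.sqrt (2 * Real.log (1.25 / δ)) ≤ c) :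
    gaussianReal 0 1 (Set.Ioi (c - ε / (2 * c))) ≤ ENNReal.ofReal δ := by
  have hl : (1:ℝ) / 5 ≤ Real.log (1.25 / δ) := by
    have h1 : (1.25:ℝ) ≤ 1.25 / δ := by
      rw [le_div_iff₀ hδ]; nlinarith
    have h2 := Real.one_sub_inv_le_log_of_pos (x := 1.25 / δ) (by positivity)
    have h3 : (1.25 / δ)⁻¹ ≤ (1.25:ℝ)⁻¹ := inv_anti₀ (by norm_num) h1
    have h4 : (1.25:ℝ)⁻¹ = 4 / 5 := by norm_num
    rw [h4] at h3
    linarith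
  have hc2 : 2 * Real.log (1.25 / δ) ≤ c ^ 2 := by
    have := (Real.sqrt_le_iff.1 hc).2
    exact this
  have hc0 : 0 ≤ c := (Real.sqrt_nonneg _).trans hc
  have hc6 : 3 / 5 ≤ c := by nlinarith
  have hcp : 0 < c := by linarith
  have hδc : 5 / 4 * Real.exp (-c ^ 2 / 2) ≤ δ := by
    have h1 : 1.25 / δ ≤ Real.exp (c ^ 2 / 2) := by
      rw [← Real.log_le_iff_le_exp (by positivity)]; linarith
    rw [div_le_iff₀ hδ] at h1
    have h2 : Real.exp (-c ^ 2 / 2) * Real.exp (c ^ 2 / 2) = 1 := by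
      rw [← Real.exp_add, ← Real.exp_zero]; congr 1; ring
    have h3 := Real.exp_pos (-c ^ 2 / 2)
    have h4 := mul_le_mul_of_nonneg_left h1 h3.le
    rw [← mul_assoc, h2] at h4
    linarith
  set r := ε / (2 * c) with hr
  have hrc : r * c = ε / 2 := by rw [hr]; field_simp
  have hr0 : 0 < r := by positivity
  rcases le_total 0 (c - r) with ht | ht
  · refine (gm_tail_pos ht).trans (ENNReal.ofReal_le_ofReal (le_trans ?_ hδc))
    have h1 : Real.exp (-(c - r) ^ 2 / 2) ≤ Real.exp (-c ^ 2 / 2) * Real.exp (1 / 2) := by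
      rw [← Real.exp_add]
      refine Real.exp_le_exp.2 ?_
      nlinarith [sq_nonneg r]
    have h2 : Real.exp (1 / 2) ≤ 5 / 2 := by
      have h5 : Real.exp (1 / 2) ^ 2 = Real.exp 1 := by
        rw [← Real.exp_nat_mul]; norm_num
      have := Real.exp_one_lt_d9
      nlinarith [Real.exp_pos (1 / 2)]
    nlinarith [Real.exp_pos (-c ^ 2 / 2)]
  · refine (gm_tail_neg ht).trans (ENNReal.ofReal_le_ofReal (le_trans ?_ hδc))
    have h1 : c ^ 2 ≤ 1 / 2 := by nlinarith
    have h2 := Real.add_one_le_exp (-c ^ 2 / 2)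
    have h3 : r ≤ 5 / 6 := by
      nlinarith
    linarith

lemma gm_inner_law {p : ℕ} (w : Fin p → ℝ) (v : NNReal) :
    (Measure.pi fun _ : Fin p => gaussianReal 0 v).map (fun y => ∑ i, w i * y i)
      = gaussianReal 0 (Real.toNNReal (∑ i, w i ^ 2) * v) := by
  have hm : Measurable (fun y : Fin p → ℝ => ∑ i, w i * y i) := by fun_prop
  have : IsProbabilityMeasure ((Measure.pi fun _ : Fin p => gaussianReal 0 v).map
    (fun y => ∑ i, w i * y i)) := Measure.isProbabilityMeasure_map hm.aemeasurable
  have hmi : ∀ i, Measurable (fun y : Fin p → ℝ => w i * y i) := fun i => by fun_prop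
  refine Measure.ext_of_charFun ?_
  rw [iIndepFun.charFun_map_fun_sum_eq_prod (X := fun i (y : Fin p → ℝ) => w i * y i)
    (fun i => (hmi i).aemeasurable)
    (iIndepFun_pi (X := fun i (x : ℝ) => w i * x) (fun i => by fun_prop))]
  ext t
  have h1 : ∀ i, (Measure.pi fun _ : Fin p => gaussianReal 0 v).map
      (fun y : Fin p → ℝ => w i * y i) = gaussianReal 0 (NNReal.mk (w i ^ 2) (sq_nonneg _) * v) := by
    intro i
    have h2 := gaussianReal_map_const_mul (μ := 0) (v := v) (w i)
    rw [mul_zero] at h2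
    have h4 := (measurePreserving_eval (fun _ : Fin p => gaussianReal 0 v) i).map_eq
    have h5 : Measurable (fun x : ℝ => w i * x) := by fun_prop
    have h6 := Measure.map_map (μ := Measure.pi fun _ : Fin p => gaussianReal 0 v) h5
      (measurable_pi_apply i)
    rw [← h2]
    exact h6.symm.trans (congrArg _ h4)
  rw [Finset.prod_apply]
  simp only [h1, charFun_gaussianReal]
  rw [← Complex.exp_sum]
  congr 1
  have h3 : (0:ℝ) ≤ ∑ i, w i ^ 2 := Finset.sum_nonneg fun i _ => sq_nonneg _
  simp only [NNReal.coe_mul, Real.coe_toNNReal _ h3, NNReal.coe_mk]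
  push_cast
  simp only [mul_zero, zero_mul, zero_sub, Finset.sum_neg_distrib, Finset.sum_mul,
    Finset.sum_div]

/-- Gaussian mechanism: if `‖q − q'‖₂ ≤ Δ` and
`σ ≥ √(2·ln(1.25/δ))·Δ/ε`, then the laws of `q + Y` and `q' + Y`, where `Y` has i.i.d.
`N(0, σ²)` coordinates, satisfy the `(ε, δ)`-differential-privacy inequality on every
measurable set. -/
theorem gaussian_mechanism (p : ℕ) (ε δ : ℝ) (hε : 0 < ε) (hε1 : ε ≤ 1)
    (hδ : 0 < δ) (hδ1 : δ ≤ 1) (Δ : ℝ) (hΔ : 0 < Δ)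
    (q q' : Fin p → ℝ) (hqq : Real.sqrt (∑ i, (q i - q' i) ^ 2) ≤ Δ)
    (σ : ℝ) (hσ : Real.sqrt (2 * Real.log (1.25 / δ)) * Δ / ε ≤ σ) :
    ∀ S : Set (Fin p → ℝ), MeasurableSet S →
      ((Measure.pi fun _ : Fin p => gaussianReal 0 (Real.toNNReal (σ ^ 2))).map
          (fun y => q + y)) S
        ≤ ENNReal.ofReal (Real.exp ε) *
            ((Measure.pi fun _ : Fin p => gaussianReal 0 (Real.toNNReal (σ ^ 2))).map
              (fun y => q' + y)) S
          + ENNReal.ofReal δ := by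
  intro S hS
  have hΔσ : Real.sqrt (2 * Real.log (1.25 / δ)) * Δ ≤ σ * ε := by
    rwa [div_le_iff₀ hε] at hσ
  have hl : 0 < Real.log (1.25 / δ) := by
    refine Real.log_pos ?_
    rw [lt_div_iff₀ hδ]; linarith
  have hs0 : 0 < Real.sqrt (2 * Real.log (1.25 / δ)) := Real.sqrt_pos.2 (by linarith)
  have hσ0 : 0 < σ := lt_of_lt_of_le (by positivity) hσ
  set v : NNReal := Real.toNNReal (σ ^ 2) with hvdef
  have hv : (v : ℝ) = σ ^ 2 := Real.coe_toNNReal _ (sq_nonneg _)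
  have hv0 : v ≠ 0 := by
    intro h
    rw [h] at hv
    simp only [NNReal.coe_zero] at hv
    nlinarith
  set d := Real.sqrt (∑ i, (q i - q' i) ^ 2) with hd
  have hsum : (0:ℝ) ≤ ∑ i, (q i - q' i) ^ 2 := Finset.sum_nonneg fun i _ => sq_nonneg _
  have hd2 : d ^ 2 = ∑ i, (q i - q' i) ^ 2 := Real.sq_sqrt hsum
  have hdn : 0 ≤ d := Real.sqrt_nonneg _
  rcases hdn.eq_or_lt with hd0 | hd0
  · have hq : q = q' := by
      rw [← hd0] at hd2
      have h0 : ∑ i, (q i - q' i) ^ 2 = 0 := by rw [← hd2]; norm_num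
      rw [Finset.sum_eq_zero_iff_of_nonneg fun i _ => sq_nonneg _] at h0
      ext i
      have := h0 i (Finset.mem_univ i)
      have := pow_eq_zero_iff (two_ne_zero) |>.1 this
      linarith
    rw [hq]
    refine le_trans ?_ le_self_add
    conv_lhs => rw [← one_mul (Measure.map _ _ S)]
    gcongr
    rw [ENNReal.one_le_ofReal, Real.one_le_exp_iff]
    exact hε.le
  have hmap : ∀ a : Fin p → ℝ,
      (Measure.pi fun _ : Fin p => gaussianReal 0 v).map (fun y => a + y)
        = Measure.pi (fun i => gaussianReal (a i) v) := by
    intro a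
    have h1 : ∀ i, (gaussianReal 0 v).map (fun x => a i + x) = gaussianReal (a i) v := by
      intro i
      have h2 := gaussianReal_map_const_add (μ := 0) (v := v) (a i)
      rwa [zero_add] at h2
    have : ∀ i, SigmaFinite ((gaussianReal 0 v).map (fun x => a i + x)) := by
      intro i; rw [h1]; infer_instance
    have h3 := Measure.pi_map_pi (μ := fun _ : Fin p => gaussianReal 0 v)
      (f := fun i (x : ℝ) => a i + x) (fun i => by fun_prop)
    simp only [h1] at h3
    exact h3
  set F : Fin p → ℝ → ENNReal := fun i x =>
    ENNReal.ofReal (Real.exp (((x - q' i) ^ 2 - (x - q i) ^ 2) / (2 * v))) with hF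
  have hFm : ∀ i, Measurable (F i) := fun i => by fun_prop
  have hdens : ∀ i, (gaussianReal (q' i) v).withDensity (F i) = gaussianReal (q i) v :=
    fun i => (gm_real_density (q i) (q' i) hv0).symm
  have hprob : ∀ i, IsProbabilityMeasure ((gaussianReal (q' i) v).withDensity (F i)) := by
    intro i; rw [hdens]; infer_instance
  have hpi := gm_pi_density (fun i => gaussianReal (q' i) v) F hFm
  simp only [hdens] at hpi
  set G : (Fin p → ℝ) → ENNReal := fun x => ∏ i, F i (x i) with hG
  have hGm : Measurable G :=
    Finset.measurable_prod _ fun i _ => (hFm i).comp (measurable_pi_apply i)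
  have hGe : ∀ x, G x = ENNReal.ofReal
      (Real.exp (∑ i, ((x i - q' i) ^ 2 - (x i - q i) ^ 2) / (2 * v))) := by
    intro x
    rw [Real.exp_sum, ENNReal.ofReal_prod_of_nonneg fun i _ => (Real.exp_pos _).le]
  set K := ENNReal.ofReal (Real.exp ε) with hK
  set B : Set (Fin p → ℝ) := {x | K < G x} with hB
  have hBm : MeasurableSet B := measurableSet_lt measurable_const hGm
  have hsplit : S ⊆ (S \ B) ∪ B := by
    intro x hx
    by_cases h : x ∈ B
    · exact Or.inr h
    · exact Or.inl ⟨hx, h⟩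
  have hbad : (Measure.pi fun _ : Fin p => gaussianReal 0 v).map (fun y => q + y) B
      ≤ ENNReal.ofReal δ := by
    rw [Measure.map_apply (by fun_prop) hBm]
    set c := σ * ε / d with hc
    have hcs : Real.sqrt (2 * Real.log (1.25 / δ)) ≤ c := by
      rw [hc, le_div_iff₀ hd0]
      exact (mul_le_mul_of_nonneg_left hqq hs0.le).trans hΔσ
    refine le_trans ?_ (gm_tail hε hε1 hδ hδ1 hcs)
    have hlaw : (Measure.pi fun _ : Fin p => gaussianReal 0 v).map
        (fun y => ∑ i, ((q i - q' i) / (d * σ)) * y i) = gaussianReal 0 1 := by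
      rw [gm_inner_law]
      congr 1
      have h1 : ∑ i, ((q i - q' i) / (d * σ)) ^ 2 = 1 / σ ^ 2 := by
        simp only [div_pow]
        rw [← Finset.sum_div, ← hd2]
        field_simp
      rw [h1, hvdef, ← Real.toNNReal_mul (by positivity)]
      rw [one_div, inv_mul_cancel₀ (by positivity), Real.toNNReal_one]
    rw [← hlaw, Measure.map_apply (by fun_prop) measurableSet_Ioi]
    refine measure_mono fun y hy => ?_
    have hy : K < G (q + y) := hy
    rw [hGe, hK, ENNReal.ofReal_lt_ofReal_iff (Real.exp_pos _), Real.exp_lt_exp, hv] at hy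
    simp only [Set.mem_preimage, Set.mem_Ioi]
    have h1 : ∑ i, (((q + y) i - q' i) ^ 2 - ((q + y) i - q i) ^ 2) / (2 * σ ^ 2)
        = (d ^ 2 + 2 * ∑ i, (q i - q' i) * y i) / (2 * σ ^ 2) := by
      rw [← Finset.sum_div, hd2, Finset.mul_sum, ← Finset.sum_add_distrib]
      congr 1
      refine Finset.sum_congr rfl fun i _ => ?_
      simp only [Pi.add_apply]
      ring
    have h2 : ∑ i, ((q i - q' i) / (d * σ)) * y i
        = (∑ i, (q i - q' i) * y i) / (d * σ) := by
      rw [Finset.sum_div]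
      refine Finset.sum_congr rfl fun i _ => ?_
      ring
    rw [h1, lt_div_iff₀ (by positivity)] at hy
    rw [h2, lt_div_iff₀ (by positivity)]
    have h3 : (c - ε / (2 * c)) * (d * σ) = σ ^ 2 * ε - d ^ 2 / 2 := by
      rw [hc]; field_simp
    rw [h3]
    linarith
  have hgood : (Measure.pi fun _ : Fin p => gaussianReal 0 v).map (fun y => q + y) (S \ B)
      ≤ K * (Measure.pi fun _ : Fin p => gaussianReal 0 v).map (fun y => q' + y) S := by
    rw [hmap q, hmap q', hpi, withDensity_apply _ (hS.diff hBm)]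
    calc _ ≤ ∫⁻ _ in S \ B, K ∂(Measure.pi (fun i => gaussianReal (q' i) v)) := by
          refine setLIntegral_mono measurable_const fun x hx => ?_
          exact not_lt.1 hx.2
      _ = K * Measure.pi (fun i => gaussianReal (q' i) v) (S \ B) := by
          rw [setLIntegral_const]
      _ ≤ _ := by
          gcongr
          exact Set.sdiff_subset
  exact (measure_mono hsplit).trans ((measure_union_le _ _).trans (add_le_add hgood hbad))
end

section
/- There exists a constant C₅ > 0 depending only on σ² with the following property. Let x₁, …, xₙ be i.i.d. samples in ℝᵖ from a distribution with mean zero and sub-Gaussian marginals with parameter σ², with covariance Σ = (σ_{ij}) and empirical covariance Σ* = (σ*_{ij}) = (1/n)·Σₖ xₖxₖᵀ. Then for all 1 ≤ i, j ≤ p, E[(σ*_{ij} − σ_{ij})⁸] ≤ C₅/n. -/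
open MeasureTheory ProbabilityTheory Real

lemma aux_mul_pow (u v : ℝ) (hu : 0 ≤ u) (hv : 0 ≤ v) (a b : ℕ) (h : a + b = 8) :
    u ^ a * v ^ b ≤ u ^ 8 + v ^ 8 := by
  rcases le_total u v with huv | huv
  · calc u ^ a * v ^ b ≤ v ^ a * v ^ b := by gcongr
      _ = v ^ 8 := by rw [← pow_add, h]
      _ ≤ _ := by have := pow_nonneg hu 8; linarith
  · calc u ^ a * v ^ b ≤ u ^ a * u ^ b := by gcongr
      _ = u ^ 8 := by rw [← pow_add, h]
      _ ≤ _ := by have := pow_nonneg hv 8; linarith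

lemma aux_moment_sum {Ω : Type*} [MeasurableSpace Ω] (μ : Measure Ω) [IsProbabilityMeasure μ]
    (n : ℕ) (hn : 1 ≤ n) (Y : Fin n → Ω → ℝ) (hmeas : ∀ k, Measurable (Y k))
    (hind : iIndepFun Y μ) (h0 : ∀ k, ∫ ω, Y k ω ∂μ = 0) (M : ℝ)
    (hint : ∀ k, Integrable (fun ω => Y k ω ^ 8) μ) (hM : ∀ k, ∫ ω, Y k ω ^ 8 ∂μ ≤ M) :
    ∫ ω, (∑ k, Y k ω) ^ 8 ∂μ ≤ 14 * n ^ 7 * M := by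
  have hn0 : (0 : ℝ) < n := by exact_mod_cast hn
  let A : Ω → ℝ := fun ω => ∑ k, |Y k ω|
  let S : Ω → ℝ := fun ω => ∑ k, Y k ω
  let T : Fin n → Ω → ℝ := fun k ω => ∑ l ∈ Finset.univ.erase k, Y l ω
  have hA0 : ∀ ω, 0 ≤ A ω := fun ω => Finset.sum_nonneg fun _ _ => abs_nonneg _
  have hSA : ∀ ω, |S ω| ≤ A ω := fun ω => Finset.abs_sum_le_sum_abs _ _
  have hTA : ∀ k ω, |T k ω| ≤ A ω := fun k ω =>
    (Finset.abs_sum_le_sum_abs _ _).trans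
      (Finset.sum_le_sum_of_subset_of_nonneg (Finset.erase_subset _ _) fun _ _ _ => abs_nonneg _)
  have hYA : ∀ k ω, |Y k ω| ≤ A ω := fun k ω =>
    Finset.single_le_sum (f := fun k => |Y k ω|) (fun _ _ => abs_nonneg _) (Finset.mem_univ k)
  have hST : ∀ k ω, S ω = Y k ω + T k ω := fun k ω =>
    (Finset.add_sum_erase _ (fun l => Y l ω) (Finset.mem_univ k)).symm
  have hAm : Measurable A := by fun_prop
  have hSm : Measurable S := by fun_prop
  have hTm : ∀ k, Measurable (T k) := by intro k; fun_prop
  have hA8 : ∀ ω, A ω ^ 8 ≤ n ^ 7 * ∑ k, Y k ω ^ 8 := by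
    intro ω
    have := pow_sum_div_card_le_sum_pow (s := Finset.univ) (f := fun k => |Y k ω|)
      (fun _ _ => abs_nonneg _) 7
    rw [div_le_iff₀ (by simpa using by positivity)] at this
    simp only [Finset.card_univ, Fintype.card_fin] at this
    calc A ω ^ 8 ≤ _ := this
      _ = _ := by
        rw [mul_comm]; congr 1
        exact Finset.sum_congr rfl fun k _ => (by decide : Even 8).pow_abs _
  have hsumint : Integrable (fun ω => (n : ℝ) ^ 7 * ∑ k, Y k ω ^ 8) μ :=
    (integrable_finsetSum _ fun k _ => hint k).const_mul _
  have hAint : Integrable (fun ω => A ω ^ 8) μ := by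
    refine hsumint.mono' (by fun_prop) (.of_forall fun ω => ?_)
    rw [Real.norm_of_nonneg (pow_nonneg (hA0 ω) 8)]
    exact hA8 ω
  have hAM : ∫ ω, A ω ^ 8 ∂μ ≤ n ^ 8 * M := by
    calc ∫ ω, A ω ^ 8 ∂μ ≤ ∫ ω, (n : ℝ) ^ 7 * ∑ k, Y k ω ^ 8 ∂μ :=
          integral_mono hAint hsumint hA8
      _ = n ^ 7 * ∑ k, ∫ ω, Y k ω ^ 8 ∂μ := by
          rw [integral_const_mul, integral_finsetSum _ fun k _ => hint k]
      _ ≤ n ^ 7 * ∑ k : Fin n, M := by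
          gcongr with k; exact hM k
      _ = n ^ 8 * M := by simp; ring
  -- domination
  have hdom : ∀ k (R : Ω → ℝ), Measurable R → (∀ ω, |R ω| ≤ A ω) →
      Integrable (fun ω => Y k ω * R ω ^ 7) μ := by
    intro k R hR hRA
    refine hAint.mono' (by have := hmeas k; fun_prop) (.of_forall fun ω => ?_)
    rw [Real.norm_eq_abs, abs_mul, abs_pow]
    calc |Y k ω| * |R ω| ^ 7 ≤ A ω * A ω ^ 7 := by
          gcongr
          · exact hYA k ω
          · exact hRA ω
      _ = A ω ^ 8 := by ring
  have hT0 : ∀ k, ∫ ω, Y k ω * T k ω ^ 7 ∂μ = 0 := by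
    intro k
    have h1 := hind.indepFun_finsetSum_of_notMem hmeas (Finset.notMem_erase k Finset.univ)
    have h2 : IndepFun (Y k) (fun ω => T k ω ^ 7) μ := by
      have h3 := h1.symm.comp (φ := id) (ψ := fun x : ℝ => x ^ 7) measurable_id (by fun_prop)
      have h4 : (fun ω => T k ω ^ 7)
          = (fun x : ℝ => x ^ 7) ∘ ∑ j ∈ Finset.univ.erase k, Y j := by
        ext ω
        simp [T, Finset.sum_apply]
      rw [h4]
      exact h3
    rw [h2.integral_fun_mul_eq_mul_integral (hmeas k).aestronglyMeasurable
      ((hTm k).pow_const 7).aestronglyMeasurable, h0 k, zero_mul]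
  have hk : ∀ k, ∫ ω, Y k ω * S ω ^ 7 ∂μ ≤ 14 * n ^ 6 * M := by
    intro k
    have hpt : ∀ ω, Y k ω * S ω ^ 7 ≤ Y k ω * T k ω ^ 7
        + (7 * n ^ 6 * Y k ω ^ 8 + 7 / n ^ 2 * A ω ^ 8) := by
      intro ω
      have h1 := abs_pow_sub_pow_le (S ω) (T k ω) 7
      have h2 : S ω - T k ω = Y k ω := by rw [hST k ω]; ring
      rw [h2] at h1
      have h3 : max |S ω| |T k ω| ≤ A ω := max_le (hSA ω) (hTA k ω)
      have h4 : |S ω ^ 7 - T k ω ^ 7| ≤ |Y k ω| * 7 * A ω ^ 6 := by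
        refine h1.trans ?_
        norm_num
        gcongr
      have h5 := aux_mul_pow |Y k ω| (A ω / n) (abs_nonneg _) (div_nonneg (hA0 ω) hn0.le) 2 6 rfl
      rw [(by decide : Even 8).pow_abs] at h5
      have h6 : Y k ω * (S ω ^ 7 - T k ω ^ 7) ≤ |Y k ω| * (|Y k ω| * 7 * A ω ^ 6) := by
        refine (le_abs_self _).trans ?_
        rw [abs_mul]
        gcongr
      have h7 : |Y k ω| * (|Y k ω| * 7 * A ω ^ 6)
          = 7 * n ^ 6 * (|Y k ω| ^ 2 * (A ω / n) ^ 6) := by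
        field_simp
      have h8 : 7 * n ^ 6 * (|Y k ω| ^ 2 * (A ω / n) ^ 6)
          ≤ 7 * n ^ 6 * (Y k ω ^ 8 + (A ω / n) ^ 8) := by gcongr
      have h9 : 7 * n ^ 6 * (Y k ω ^ 8 + (A ω / n) ^ 8)
          = 7 * n ^ 6 * Y k ω ^ 8 + 7 / n ^ 2 * A ω ^ 8 := by
        field_simp
      linarith
    have i1 := hdom k (T k) (hTm k) (hTA k)
    have i2 : Integrable (fun ω => 7 * (n : ℝ) ^ 6 * Y k ω ^ 8) μ := (hint k).const_mul _
    have i3 : Integrable (fun ω => 7 / (n : ℝ) ^ 2 * A ω ^ 8) μ := hAint.const_mul _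
    have i4 : Integrable (fun ω => 7 * (n : ℝ) ^ 6 * Y k ω ^ 8 + 7 / (n : ℝ) ^ 2 * A ω ^ 8) μ :=
      i2.add i3
    calc ∫ ω, Y k ω * S ω ^ 7 ∂μ ≤ ∫ ω, (Y k ω * T k ω ^ 7
        + (7 * n ^ 6 * Y k ω ^ 8 + 7 / n ^ 2 * A ω ^ 8)) ∂μ :=
          integral_mono (hdom k S hSm hSA) (i1.add i4) hpt
      _ = 7 * n ^ 6 * ∫ ω, Y k ω ^ 8 ∂μ + 7 / n ^ 2 * ∫ ω, A ω ^ 8 ∂μ := by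
          rw [integral_add i1 i4, integral_add i2 i3, hT0 k, integral_const_mul,
            integral_const_mul, zero_add]
      _ ≤ 7 * n ^ 6 * M + 7 / n ^ 2 * (n ^ 8 * M) := by
          gcongr; exact hM k
      _ = 14 * n ^ 6 * M := by field_simp; ring
  calc ∫ ω, (∑ k, Y k ω) ^ 8 ∂μ = ∫ ω, ∑ k, Y k ω * S ω ^ 7 ∂μ := by
        congr 1; ext ω; rw [← Finset.sum_mul]; simp only [S]; ring
    _ = ∑ k, ∫ ω, Y k ω * S ω ^ 7 ∂μ := integral_finsetSum _ fun k _ => hdom k S hSm hSA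
    _ ≤ ∑ k : Fin n, 14 * (n : ℝ) ^ 6 * M := Finset.sum_le_sum fun k _ => hk k
    _ = 14 * n ^ 7 * M := by simp; ring

lemma aux_coord_moment (σ2 : ℝ) (hσ2 : 0 < σ2) :
    ∃ K : ℝ, 0 ≤ K ∧ ∀ (p : ℕ) (ν : Measure (Fin p → ℝ)), SubGaussianMarginals p σ2 ν →
      ∀ i : Fin p, Integrable (fun x : Fin p → ℝ => x i ^ 16) ν ∧ ∫ x, x i ^ 16 ∂ν ≤ K := by
  have hI := integrableOn_rpow_mul_exp_neg_mul_sq (b := 1 / (2 * σ2)) (by positivity)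
    (s := 15) (by norm_num)
  set L : ENNReal := ENNReal.ofReal 16 * ∫⁻ t in Set.Ioi (0 : ℝ),
    ENNReal.ofReal (t ^ (15 : ℝ) * Real.exp (-(1 / (2 * σ2)) * t ^ 2)) with hL
  have hLtop : L ≠ ⊤ := ENNReal.mul_ne_top ENNReal.ofReal_ne_top hI.lintegral_lt_top.ne
  refine ⟨L.toReal, ENNReal.toReal_nonneg, fun p ν hν i => ?_⟩
  have hmain : ∫⁻ x, ENNReal.ofReal (x i ^ 16) ∂ν ≤ L := by
    have h1 := lintegral_rpow_eq_lintegral_meas_lt_mul ν (f := fun x : Fin p → ℝ => |x i|)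
      (.of_forall fun x => abs_nonneg _)
      ((measurable_pi_apply i).abs.aemeasurable) (p := 16) (by norm_num)
    have h2 : ∀ x : Fin p → ℝ, |x i| ^ (16 : ℝ) = x i ^ 16 := by
      intro x
      rw [show (16 : ℝ) = ((16 : ℕ) : ℝ) by norm_num, Real.rpow_natCast]
      exact (by decide : Even 16).pow_abs _
    simp only [h2] at h1
    rw [h1, hL]
    gcongr ENNReal.ofReal 16 * ?_
    refine setLIntegral_mono' measurableSet_Ioi fun t ht => ?_
    have ht0 : (0 : ℝ) < t := ht
    have h3 := hν (Pi.single i 1) (by simp [Pi.single_apply]) t ht0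
    simp only [Pi.single_apply, ite_mul, one_mul, zero_mul, Finset.sum_ite_eq',
      Finset.mem_univ, if_true] at h3
    rw [mul_comm (t ^ (15 : ℝ)), ENNReal.ofReal_mul (Real.exp_pos _).le]
    norm_num only
    refine mul_le_mul_left (h3.trans_eq ?_) _
    congr 2
    field_simp
  have hnn : 0 ≤ᵐ[ν] fun x : Fin p → ℝ => x i ^ 16 :=
    .of_forall fun x => (by decide : Even 16).pow_nonneg _
  have hm : AEStronglyMeasurable (fun x : Fin p → ℝ => x i ^ 16) ν :=
    ((measurable_pi_apply i).pow_const 16).aestronglyMeasurable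
  constructor
  · exact ⟨hm, (hasFiniteIntegral_iff_ofReal hnn).2 (hmain.trans_lt hLtop.lt_top)⟩
  · rw [integral_eq_lintegral_of_nonneg_ae hnn hm]
    exact ENNReal.toReal_mono hLtop hmain

/-- there exists a constant `C₅ > 0` depending only on `σ2` such that for
i.i.d. mean-zero sub-Gaussian samples (modeled by the product measure `ν^n`), every entry of
the empirical covariance matrix satisfies the eighth-moment bound
`E[(σ*_{ij} − σ_{ij})⁸] ≤ C₅/n`. -/
theorem empCov_eighth_moment (σ2 : ℝ) (hσ2 : 0 < σ2) :
    ∃ C₅ : ℝ, 0 < C₅ ∧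
      ∀ (p n : ℕ), 1 ≤ n →
      ∀ (ν : Measure (Fin p → ℝ)) [IsProbabilityMeasure ν],
        SubGaussianMarginals p σ2 ν → MeanZero p ν →
        ∀ i j : Fin p,
          ∫ x, (empCov p n x i j - popCov p ν i j) ^ 8
              ∂(Measure.pi fun _ : Fin n => ν)
            ≤ C₅ / n := by
  obtain ⟨K, hK0, hK⟩ := aux_coord_moment σ2 hσ2
  refine ⟨14 * (2 ^ 7 * (2 * K + (1 + 2 * K) ^ 8)) + 1, by positivity, ?_⟩
  intro p n hn ν _ hν _ i j
  have hn0 : (0 : ℝ) < n := by exact_mod_cast hn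
  obtain ⟨hi, hiK⟩ := hK p ν hν i
  obtain ⟨hj, hjK⟩ := hK p ν hν j
  set s : ℝ := ∫ x, x i * x j ∂ν with hs
  have hP8 : ∀ x : Fin p → ℝ, (x i * x j) ^ 8 ≤ x i ^ 16 + x j ^ 16 := by
    intro x
    nlinarith [sq_nonneg (x i ^ 8 - x j ^ 8), sq_nonneg (x i ^ 8), sq_nonneg (x j ^ 8)]
  have hPint : Integrable (fun x : Fin p → ℝ => (x i * x j) ^ 8) ν := by
    refine (hi.add hj).mono' (by fun_prop) (.of_forall fun x => ?_)
    rw [Real.norm_of_nonneg ((by decide : Even 8).pow_nonneg _)]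
    exact hP8 x
  have hPK : ∫ x, (x i * x j) ^ 8 ∂ν ≤ 2 * K := by
    have := integral_mono hPint (hi.add hj) hP8
    have h2 := integral_add hi hj
    simp only [Pi.add_apply] at this
    linarith
  have habs : ∀ x : Fin p → ℝ, ‖x i * x j‖ ≤ 1 + (x i * x j) ^ 8 := by
    intro x
    have := aux_mul_pow |x i * x j| 1 (abs_nonneg _) zero_le_one 1 7 rfl
    rw [(by decide : Even 8).pow_abs] at this
    rw [Real.norm_eq_abs]
    linarith
  have hint1 : Integrable (fun x : Fin p → ℝ => 1 + (x i * x j) ^ 8) ν :=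
    (integrable_const 1).add hPint
  have hPint1 : Integrable (fun x : Fin p → ℝ => x i * x j) ν :=
    hint1.mono' (by fun_prop) (.of_forall habs)
  have hsK : |s| ≤ 1 + 2 * K := by
    have h1 := norm_integral_le_of_norm_le hint1 (.of_forall habs)
    rw [integral_add (integrable_const 1) hPint] at h1
    simp only [integral_const, probReal_univ, smul_eq_mul, one_mul, Real.norm_eq_abs] at h1
    linarith
  have hs8 : s ^ 8 ≤ (1 + 2 * K) ^ 8 := by
    rw [← (by decide : Even 8).pow_abs]
    gcongr
  let g : (Fin p → ℝ) → ℝ := fun x => x i * x j - s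
  have hgm : Measurable g := by fun_prop
  have hg8 : ∀ x, g x ^ 8 ≤ 2 ^ 7 * ((x i * x j) ^ 8 + s ^ 8) := by
    intro x
    have h1 := add_pow_le (abs_nonneg (x i * x j)) (abs_nonneg s) 8
    rw [(by decide : Even 8).pow_abs, (by decide : Even 8).pow_abs] at h1
    refine le_trans ?_ h1
    rw [← (by decide : Even 8).pow_abs (g x)]
    gcongr
    exact abs_sub _ _
  have hbint : Integrable (fun x : Fin p → ℝ => 2 ^ 7 * ((x i * x j) ^ 8 + s ^ 8)) ν :=
    (hPint.add (integrable_const _)).const_mul _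
  have hgint : Integrable (fun x => g x ^ 8) ν := by
    refine hbint.mono' (by fun_prop) (.of_forall fun x => ?_)
    rw [Real.norm_of_nonneg ((by decide : Even 8).pow_nonneg _)]
    exact hg8 x
  have hgM : ∫ x, g x ^ 8 ∂ν ≤ 2 ^ 7 * (2 * K + (1 + 2 * K) ^ 8) := by
    have h1 := integral_mono hgint hbint hg8
    rw [integral_const_mul, integral_add hPint (integrable_const _)] at h1
    simp only [integral_const, probReal_univ, smul_eq_mul, one_mul] at h1
    linarith
  have hg0 : ∫ x, g x ∂ν = 0 := by
    simp only [g]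
    rw [integral_sub hPint1 (integrable_const _)]
    simp [hs]
  have hmp : ∀ k : Fin n, MeasurePreserving (Function.eval k)
      (Measure.pi fun _ : Fin n => ν) ν := fun k => measurePreserving_eval (fun _ => ν) k
  have hcomp : ∀ (k : Fin n) (f : (Fin p → ℝ) → ℝ), Measurable f →
      ∫ x, f (x k) ∂(Measure.pi fun _ : Fin n => ν) = ∫ x, f x ∂ν := by
    intro k f hf
    conv_rhs => rw [← (hmp k).map_eq]
    rw [integral_map (hmp k).measurable.aemeasurable hf.aestronglyMeasurable]
  have hfin := aux_moment_sum (Measure.pi fun _ : Fin n => ν) n hn (fun k x => g (x k))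
    (fun k => hgm.comp (measurable_pi_apply k))
    (iIndepFun_pi (X := fun _ : Fin n => g) fun _ => hgm.aemeasurable)
    (fun k => (hcomp k g hgm).trans hg0) _
    (fun k => (hmp k).integrable_comp_of_integrable hgint)
    (fun k => (hcomp k (fun x => g x ^ 8) (hgm.pow_const 8)).trans_le hgM)
  have heq : ∀ x : Fin n → Fin p → ℝ, (empCov p n x i j - popCov p ν i j) ^ 8
      = (1 / n ^ 8) * (∑ k, g (x k)) ^ 8 := by
    intro x
    have : empCov p n x i j - popCov p ν i j = (1 / n) * ∑ k, g (x k) := by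
      simp only [empCov, popCov, Matrix.of_apply, g, Finset.sum_sub_distrib, ← hs]
      simp
      field_simp
    rw [this]; ring
  simp only [heq]
  rw [integral_const_mul]
  calc _ ≤ 1 / (n : ℝ) ^ 8 * (14 * n ^ 7 * (2 ^ 7 * (2 * K + (1 + 2 * K) ^ 8))) := by gcongr
    _ = 14 * (2 ^ 7 * (2 * K + (1 + 2 * K) ^ 8)) / n := by field_simp
    _ ≤ _ := by gcongr; linarith
end
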